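/- arXiv:math/0503620 — 5 statements merged into one kernel-verified Lean document; each statement's English description precedes it below -/
import Mathlib

section
/- Let F be a field and let A and B be finite nonempty subsets of F. Let P(x,y) be a polynomial in F[x,y], and set C = {a+b : a ∈ A, b ∈ B, and P(a,b) ≠ 0}. If C is nonempty, then |C| ≥ |A| + |B| - deg P - min_{c ∈ C} ν_{A,B}(c). -/
open Finset in
/-- The weighted power sums `∑ aᵏ / ∏ (a - a')` vanish for `k + 1 < |A|`. -/
theorem Lagrange.sum_pow_mul_nodalWeight_eq_zero {F : Type*} [Field F] [DecidableEq F]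
    (A : Finset F) {k : ℕ} (hk : k + 1 < #A) :
    ∑ a ∈ A, a ^ k * Lagrange.nodalWeight A id a = 0 := by
  have hdeg : (Polynomial.X ^ k : Polynomial F).degree < #A := by
    rw [Polynomial.degree_X_pow]
    exact_mod_cast (by omega : k < #A)
  have h := Lagrange.coeff_eq_sum (s := A) (v := id) Function.injective_id.injOn hdeg
  rw [Polynomial.coeff_X_pow, if_neg (by omega)] at h
  simpa [Lagrange.nodalWeight, div_eq_mul_inv] using h.symm

open Finset in
/-- A polynomial of total degree less than `|A| + |B| - 2` is annihilated by the product of the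
top-order divided differences on `A` and `B`. -/
theorem MvPolynomial.sum_eval_mul_nodalWeight_eq_zero {F : Type*} [Field F] [DecidableEq F]
    (A B : Finset F) (f : MvPolynomial (Fin 2) F) (hf : f.totalDegree + 2 < #A + #B) :
    ∑ a ∈ A, ∑ b ∈ B, MvPolynomial.eval ![a, b] f *
      (Lagrange.nodalWeight A id a * Lagrange.nodalWeight B id b) = 0 := by
  calc
    _ = ∑ d ∈ f.support, f.coeff d *
        ((∑ a ∈ A, a ^ d 0 * Lagrange.nodalWeight A id a) *
          ∑ b ∈ B, b ^ d 1 * Lagrange.nodalWeight B id b) := by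
      simp_rw [MvPolynomial.eval_eq', Fin.prod_univ_two, sum_mul_sum, mul_sum, sum_mul]
      simp_rw [sum_comm (s := B) (t := f.support)]
      rw [sum_comm]
      refine sum_congr rfl fun d _ => sum_congr rfl fun a _ => sum_congr rfl fun b _ => ?_
      simp only [Matrix.cons_val_zero, Matrix.cons_val_one]
      ring
    _ = 0 := sum_eq_zero fun d hd => by
      have hle := MvPolynomial.le_totalDegree hd
      rw [Finsupp.sum_fintype _ _ fun _ => rfl, Fin.sum_univ_two] at hle
      rcases lt_or_ge (d 0 + 1) #A with h | h
      · rw [Lagrange.sum_pow_mul_nodalWeight_eq_zero A h, zero_mul, mul_zero]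
      · rw [Lagrange.sum_pow_mul_nodalWeight_eq_zero B (by omega), mul_zero, mul_zero]

open Finset in
/-- A polynomial that is nonzero at exactly one point of the grid `A × B` has total degree at
least `|A| + |B| - 2`. -/
theorem MvPolynomial.card_add_card_le_totalDegree_add_two {F : Type*} [Field F] [DecidableEq F]
    (A B : Finset F) (f : MvPolynomial (Fin 2) F) {a₀ b₀ : F} (ha₀ : a₀ ∈ A) (hb₀ : b₀ ∈ B)
    (h₀ : MvPolynomial.eval ![a₀, b₀] f ≠ 0)
    (h : ∀ a ∈ A, ∀ b ∈ B, MvPolynomial.eval ![a, b] f ≠ 0 → a = a₀ ∧ b = b₀) :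
    #A + #B ≤ f.totalDegree + 2 := by
  by_contra! hlt
  have hsum := MvPolynomial.sum_eval_mul_nodalWeight_eq_zero A B f hlt
  rw [sum_eq_single_of_mem a₀ ha₀, sum_eq_single_of_mem b₀ hb₀] at hsum
  · exact mul_ne_zero h₀ (mul_ne_zero
      (Lagrange.nodalWeight_ne_zero Function.injective_id.injOn ha₀)
      (Lagrange.nodalWeight_ne_zero Function.injective_id.injOn hb₀)) hsum
  · intro b hb hne
    rw [not_not.mp fun hv => hne (h a₀ ha₀ b hb hv).2, zero_mul]
  · intro a ha hne
    refine sum_eq_zero fun b hb => ?_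
    rw [not_not.mp fun hv => hne (h a ha b hb hv).1, zero_mul]

open Finset in
/-- If `C` contains every sum `a + b` with `P(a, b) ≠ 0`, and the sum `a₀ + b₀` has only one
representation, then `|A| + |B| ≤ deg P + |C| + 1`. -/
theorem card_add_card_le_of_unique_sum {F : Type*} [Field F] [DecidableEq F]
    (A B C : Finset F) (P : MvPolynomial (Fin 2) F) {a₀ b₀ : F} (ha₀ : a₀ ∈ A) (hb₀ : b₀ ∈ B)
    (h₀ : MvPolynomial.eval ![a₀, b₀] P ≠ 0)
    (hC : ∀ a ∈ A, ∀ b ∈ B, MvPolynomial.eval ![a, b] P ≠ 0 → a + b ∈ C)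
    (huniq : ∀ a ∈ A, ∀ b ∈ B, a + b = a₀ + b₀ → a = a₀ ∧ b = b₀) :
    #A + #B ≤ P.totalDegree + #C + 1 := by
  let Q : MvPolynomial (Fin 2) F := ∏ c ∈ C.erase (a₀ + b₀),
    (MvPolynomial.X 0 + MvPolynomial.X 1 - MvPolynomial.C c)
  have hQ (a b : F) : MvPolynomial.eval ![a, b] Q = ∏ c ∈ C.erase (a₀ + b₀), (a + b - c) := by
    simp [Q]
  have hdegQ : Q.totalDegree ≤ #(C.erase (a₀ + b₀)) := by
    refine (MvPolynomial.totalDegree_finsetProd _ _).trans ?_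
    refine (sum_le_card_nsmul _ _ 1 fun c _ => ?_).trans_eq (by simp)
    refine (MvPolynomial.totalDegree_sub_C_le _ _).trans ((MvPolynomial.totalDegree_add _ _).trans ?_)
    simp [MvPolynomial.totalDegree_X]
  have hcard := card_erase_add_one (hC a₀ ha₀ b₀ hb₀ h₀)
  have hmul := MvPolynomial.totalDegree_mul P Q
  have := MvPolynomial.card_add_card_le_totalDegree_add_two A B (P * Q) ha₀ hb₀
    (by
      rw [map_mul, hQ]
      exact mul_ne_zero h₀ (prod_ne_zero_iff.mpr fun c hc =>
        sub_ne_zero_of_ne (ne_of_mem_erase hc).symm))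
    (by
      intro a ha b hb hne
      rw [map_mul, hQ] at hne
      refine huniq a ha b hb (by_contra fun hab => right_ne_zero_of_mul hne ?_)
      exact prod_eq_zero (mem_erase.mpr ⟨hab, hC a ha b hb (left_ne_zero_of_mul hne)⟩)
        (sub_self _))
  omega

/-- **Theorem 1.1** (Pan–Sun). Let `A` and `B` be finite nonempty subsets of a field `F`,
let `P(x,y) ∈ F[x,y]`, and let `C = {a + b : a ∈ A, b ∈ B, P(a,b) ≠ 0}`. If `C` is nonempty,
then `|C| ≥ |A| + |B| - deg P - min_{c ∈ C} ν_{A,B}(c)`, where `ν_{A,B}(c)` is the number of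
pairs `(a,b) ∈ A × B` with `a + b = c`. -/
theorem stmt0 {F : Type*} [Field F] [DecidableEq F]
    (A B : Finset F) (hA : A.Nonempty) (hB : B.Nonempty)
    (P : MvPolynomial (Fin 2) F)
    (C : Finset F)
    (hC : C = ((A ×ˢ B).filter fun p => MvPolynomial.eval ![p.1, p.2] P ≠ 0).image
      fun p => p.1 + p.2)
    (hCne : C.Nonempty) :
    (C.card : ℤ) ≥ (A.card : ℤ) + B.card - P.totalDegree -
      C.inf' hCne (fun c => (((A ×ˢ B).filter fun p => p.1 + p.2 = c).card : ℤ)) := by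
  obtain ⟨c₀, hc₀, hmin⟩ := C.exists_mem_eq_inf' hCne
    (fun c => (((A ×ˢ B).filter fun p => p.1 + p.2 = c).card : ℤ))
  rw [hmin]
  have hmem : ∀ a ∈ A, ∀ b ∈ B, MvPolynomial.eval ![a, b] P ≠ 0 → a + b ∈ C := by
    intro a ha b hb hne
    rw [hC]
    exact Finset.mem_image.mpr ⟨(a, b), by simp [ha, hb, hne], rfl⟩
  rw [hC] at hc₀
  obtain ⟨⟨a₀, b₀⟩, hp, rfl⟩ := Finset.mem_image.mp hc₀
  simp only [Finset.mem_filter, Finset.mem_product] at hp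
  obtain ⟨⟨ha₀, hb₀⟩, h₀⟩ := hp
  set S := (A ×ˢ B).filter fun p => p.1 + p.2 = a₀ + b₀ with hS
  have hmemS (a b : F) : (a, b) ∈ S ↔ (a ∈ A ∧ b ∈ B) ∧ a + b = a₀ + b₀ := by simp [hS]
  let D := (S.erase (a₀, b₀)).image Prod.fst
  have ha₀D : a₀ ∉ D := by
    intro hmemD
    obtain ⟨⟨a, b⟩, hab, rfl⟩ := Finset.mem_image.mp hmemD
    obtain ⟨hne, habS⟩ := Finset.mem_erase.mp hab
    exact hne (Prod.ext rfl (add_left_cancel ((hmemS _ _).mp habS).2))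
  have hmain := card_add_card_le_of_unique_sum (A \ D) B C P
    (Finset.mem_sdiff.mpr ⟨ha₀, ha₀D⟩) hb₀ h₀
    (fun a ha b hb => hmem a (Finset.mem_sdiff.mp ha).1 b hb)
    (fun a ha b hb hab => by
      by_contra hne
      obtain ⟨haA, haD⟩ := Finset.mem_sdiff.mp ha
      refine haD (Finset.mem_image.mpr ⟨(a, b), Finset.mem_erase.mpr ⟨?_, ?_⟩, rfl⟩)
      · simpa using hne
      · exact (hmemS a b).mpr ⟨⟨haA, hb⟩, hab⟩)
  have hDcard : D.card ≤ (S.erase (a₀, b₀)).card := Finset.card_image_le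
  have hScard := Finset.card_erase_add_one ((hmemS a₀ b₀).mpr ⟨⟨ha₀, hb₀⟩, rfl⟩)
  have hAcard := Finset.le_card_sdiff D A
  omega
end

section
/- Let G be an abelian group whose torsion subgroup Tor(G) = {g ∈ G : g has finite order} is cyclic, and let A and B be finite nonempty subsets of G. For i = 1, …, l let m_i and n_i be nonnegative integers and let d_i ∈ G. Suppose that the set C = {a+b : a ∈ A, b ∈ B, and m_i·a - n_i·b ≠ d_i for all i = 1, …, l} is nonempty. Then |C| ≥ |A| + |B| - Σ_{i=1}^{l} (m_i + n_i) - min_{c ∈ C} ν_{A,B}(c). -/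
open MvPolynomial MonomialOrder in
/-- A polynomial which is nonzero at exactly one point of a grid `A × B` has total degree at least
`(|A| - 1) + (|B| - 1)`. -/
theorem MvPolynomial.card_add_card_le_of_unique_eval_ne_zero {F : Type*} [Field F]
    (A B : Finset F) (f : MvPolynomial (Fin 2) F) {a₀ b₀ : F} (ha₀ : a₀ ∈ A) (hb₀ : b₀ ∈ B)
    (h₀ : eval ![a₀, b₀] f ≠ 0)
    (h : ∀ a ∈ A, ∀ b ∈ B, eval ![a, b] f ≠ 0 → a = a₀ ∧ b = b₀) :
    A.card + B.card ≤ f.totalDegree + 2 := by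
  classical
  by_contra! hlt
  have hA : 0 < A.card := Finset.card_pos.2 ⟨a₀, ha₀⟩
  have hB : 0 < B.card := Finset.card_pos.2 ⟨b₀, hb₀⟩
  let P : Finset F → Fin 2 → MvPolynomial (Fin 2) F := fun S i => ∏ s ∈ S, (X i - C s)
  have hP (S i) : MonomialOrder.degLex.Monic (P S i) :=
    MonomialOrder.Monic.prod fun r _ => MonomialOrder.degLex.monic_X_sub_C i r
  have hPdeg (S i) : MonomialOrder.degLex.degree (P S i) = Finsupp.single i S.card := by
    rw [MonomialOrder.degree_prod_of_regular]
    · simp [MonomialOrder.degree_X_sub_C]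
    · intro r _
      rw [MonomialOrder.monic_X_sub_C]
      exact isRegular_one
  set g := P (A.erase a₀) 0 * P (B.erase b₀) 1 with hg
  have hgm : MonomialOrder.degLex.Monic g := (hP _ _).mul (hP _ _)
  set t : Fin 2 →₀ ℕ := Finsupp.single 0 (A.card - 1) + Finsupp.single 1 (B.card - 1) with ht
  have hgt : MonomialOrder.degLex.degree g = t := by
    rw [hg, MonomialOrder.degree_mul (hP _ _).ne_zero (hP _ _).ne_zero, hPdeg, hPdeg,
      Finset.card_erase_of_mem ha₀, Finset.card_erase_of_mem hb₀]
  have hgdeg : g.totalDegree = t.degree := by rw [← degree_degLexDegree, hgt]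
  have htdeg : t.degree = A.card - 1 + (B.card - 1) := by
    rw [ht, map_add, Finsupp.degree_single, Finsupp.degree_single]
  have hgc : g.coeff t = 1 := hgt ▸ hgm.coeff_degree
  have hge (a b : F) : eval ![a, b] g = (∏ s ∈ A.erase a₀, (a - s)) * ∏ s ∈ B.erase b₀, (b - s) := by
    simp [hg, P]
  have hg₀ : eval ![a₀, b₀] g ≠ 0 := by
    rw [hge, mul_ne_zero_iff, Finset.prod_ne_zero_iff, Finset.prod_ne_zero_iff]
    exact ⟨fun s hs => sub_ne_zero.2 (Finset.ne_of_mem_erase hs).symm,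
      fun s hs => sub_ne_zero.2 (Finset.ne_of_mem_erase hs).symm⟩
  set c := eval ![a₀, b₀] f / eval ![a₀, b₀] g with hc
  have hc₀ : c ≠ 0 := div_ne_zero h₀ hg₀
  have hft : f.coeff t = 0 := coeff_eq_zero_of_totalDegree_lt (by
    change f.totalDegree < t.degree
    omega)
  have hcoeff : (f - C c * g).coeff t ≠ 0 := by
    simpa [coeff_sub, coeff_C_mul, hft, hgc] using hc₀
  have hdeg : (f - C c * g).totalDegree = t.degree := by
    refine le_antisymm ((totalDegree_sub _ _).trans (max_le (by omega) ?_))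
      (le_totalDegree (mem_support_iff.2 hcoeff))
    exact (totalDegree_mul _ _).trans (by simp [hgdeg])
  obtain ⟨s, hs, hne⟩ := combinatorial_nullstellensatz_exists_eval_nonzero _ t hcoeff hdeg ![A, B]
    (by intro i; fin_cases i <;> simp [ht, hA, hB])
  have hs' : s = ![s 0, s 1] := by ext i; fin_cases i <;> rfl
  have hsA : s 0 ∈ A := hs 0
  have hsB : s 1 ∈ B := hs 1
  apply hne
  rw [hs']
  by_cases hs₀ : s 0 = a₀ ∧ s 1 = b₀
  · rw [hs₀.1, hs₀.2, map_sub, map_mul, eval_C, hc, div_mul_cancel₀ _ hg₀, sub_self]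
  · have hf : eval ![s 0, s 1] f = 0 := by
      by_contra hf
      exact hs₀ (h _ hsA _ hsB hf)
    have hg' : eval ![s 0, s 1] g = 0 := by
      rw [hge, mul_eq_zero]
      rcases not_and_or.1 hs₀ with hne' | hne'
      · exact .inl (Finset.prod_eq_zero (Finset.mem_erase.2 ⟨hne', hsA⟩) (sub_self _))
      · exact .inr (Finset.prod_eq_zero (Finset.mem_erase.2 ⟨hne', hsB⟩) (sub_self _))
    rw [map_sub, map_mul, hf, hg', mul_zero, sub_zero]

theorem MvPolynomial.totalDegree_X_sub_C_le {R σ : Type*} [CommRing R] (i : σ) (r : R) :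
    (X i - C r : MvPolynomial σ R).totalDegree ≤ 1 := by
  cases subsingleton_or_nontrivial R
  · simp [Subsingleton.elim (X i - C r : MvPolynomial σ R) 0]
  exact (totalDegree_sub_C_le _ _).trans (totalDegree_X i).le

open MvPolynomial in
/-- A weak form of the Alon–Füredi theorem in two variables: if a polynomial of degree `D` does not
vanish identically on the grid `A × B`, then it is nonzero at at least `|A| + |B| - D - 1` of its
points. -/
theorem MvPolynomial.card_add_card_le_card_eval_ne_zero {F : Type*} [Field F] [DecidableEq F]
    (A B : Finset F) (f : MvPolynomial (Fin 2) F) {a₀ b₀ : F} (ha₀ : a₀ ∈ A) (hb₀ : b₀ ∈ B)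
    (h₀ : eval ![a₀, b₀] f ≠ 0) :
    A.card + B.card ≤
      f.totalDegree + ((A ×ˢ B).filter fun p => eval ![p.1, p.2] f ≠ 0).card + 1 := by
  set N := (A ×ˢ B).filter fun p => eval ![p.1, p.2] f ≠ 0 with hN
  have hmem : (a₀, b₀) ∈ N := by simp [hN, ha₀, hb₀, h₀]
  let q : F × F → MvPolynomial (Fin 2) F := fun p =>
    if p.1 = a₀ then X 1 - C p.2 else X 0 - C p.1
  have hq (p) : (q p).totalDegree ≤ 1 := by
    dsimp only [q]
    split_ifs <;> exact totalDegree_X_sub_C_le _ _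
  have hq₀ (p) (hp : p ≠ (a₀, b₀)) : eval ![a₀, b₀] (q p) ≠ 0 := by
    obtain ⟨x, y⟩ := p
    by_cases hx : x = a₀
    · subst hx
      simpa [q, sub_eq_zero, eq_comm] using hp
    · simpa [q, hx, sub_eq_zero] using Ne.symm hx
  have hqp (p : F × F) : eval ![p.1, p.2] (q p) = 0 := by
    dsimp only [q]
    split_ifs <;> simp
  have key := card_add_card_le_of_unique_eval_ne_zero A B (f * ∏ p ∈ N.erase (a₀, b₀), q p) ha₀ hb₀
    (by
      rw [map_mul, eval_prod]
      exact mul_ne_zero h₀ (Finset.prod_ne_zero_iff.2 fun p hp => hq₀ p (Finset.ne_of_mem_erase hp)))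
    (by
      intro a ha b hb hab
      rw [map_mul, eval_prod, mul_ne_zero_iff, Finset.prod_ne_zero_iff] at hab
      by_contra hne
      refine hab.2 (a, b) (Finset.mem_erase.2 ⟨by simpa using hne, ?_⟩) (hqp (a, b))
      simp [hN, ha, hb, hab.1])
  have hdeg : (∏ p ∈ N.erase (a₀, b₀), q p).totalDegree ≤ (N.erase (a₀, b₀)).card :=
    (totalDegree_finsetProd _ _).trans ((Finset.sum_le_sum fun p _ => hq p).trans (by simp))
  have hmul := totalDegree_mul f (∏ p ∈ N.erase (a₀, b₀), q p)
  have hcard := Finset.card_erase_add_one hmem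
  omega

open MvPolynomial in
/-- If the points of `A × B` where `P` does not vanish lie on the lines `x = c * y` with `c ∈ C`,
and `c₀ ∈ C` is attained, then `|C|` is bounded below in terms of the number of points of `A × B`
on the line `x = c₀ * y`. -/
theorem MvPolynomial.card_add_card_le_of_eval_ne_zero_imp_eq_mul {F : Type*} [Field F]
    [DecidableEq F] (A B C : Finset F) (P : MvPolynomial (Fin 2) F)
    (hC : ∀ a ∈ A, ∀ b ∈ B, eval ![a, b] P ≠ 0 → ∃ c ∈ C, a = c * b)
    {a₀ b₀ c₀ : F} (ha₀ : a₀ ∈ A) (hb₀ : b₀ ∈ B) (hc₀ : c₀ ∈ C) (hb₀' : b₀ ≠ 0)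
    (hP : eval ![a₀, b₀] P ≠ 0) (habc : a₀ = c₀ * b₀) :
    A.card + B.card ≤
      P.totalDegree + C.card + ((A ×ˢ B).filter fun p => p.1 = c₀ * p.2).card := by
  let q : F → MvPolynomial (Fin 2) F := fun c => X 0 - MvPolynomial.C c * X 1
  have hq (c) : (q c).totalDegree ≤ 1 :=
    (totalDegree_sub _ _).trans (max_le (totalDegree_X _).le
      ((totalDegree_mul _ _).trans (by simp)))
  have hqe (a b c : F) : eval ![a, b] (q c) = a - c * b := by simp [q]
  have key := card_add_card_le_card_eval_ne_zero A B (P * ∏ c ∈ C.erase c₀, q c) ha₀ hb₀ (by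
    rw [map_mul, eval_prod]
    refine mul_ne_zero hP (Finset.prod_ne_zero_iff.2 fun c hc => ?_)
    rw [hqe, habc, ← sub_mul]
    exact mul_ne_zero (sub_ne_zero.2 (Finset.ne_of_mem_erase hc).symm) hb₀')
  have hsub : ((A ×ˢ B).filter fun p => eval ![p.1, p.2] (P * ∏ c ∈ C.erase c₀, q c) ≠ 0) ⊆
      (A ×ˢ B).filter fun p => p.1 = c₀ * p.2 := by
    rintro ⟨a, b⟩ hab
    rw [Finset.mem_filter, Finset.mem_product, map_mul, eval_prod, mul_ne_zero_iff,
      Finset.prod_ne_zero_iff] at hab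
    obtain ⟨⟨ha, hb⟩, hab, hprod⟩ := hab
    obtain ⟨c, hc, hac⟩ := hC a ha b hb hab
    have hcc : c = c₀ := by
      by_contra hne
      exact hprod c (Finset.mem_erase.2 ⟨hne, hc⟩) (by rw [hqe]; exact sub_eq_zero.2 hac)
    subst hcc
    simp only [Finset.mem_filter, Finset.mem_product]
    exact ⟨⟨ha, hb⟩, hac⟩
  have hle := Finset.card_le_card hsub
  have hdeg : (∏ c ∈ C.erase c₀, q c).totalDegree ≤ (C.erase c₀).card :=
    (totalDegree_finsetProd _ _).trans ((Finset.sum_le_sum fun c _ => hq c).trans (by simp))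
  have hmul := totalDegree_mul P (∏ c ∈ C.erase c₀, q c)
  have hcard := Finset.card_erase_add_one hc₀
  omega

/-- A finitely generated abelian group with cyclic torsion subgroup embeds into `ℂˣ`. -/
theorem AddChar.exists_injective_complex {H : Type*} [AddCommGroup H] [AddGroup.FG H]
    (hTor : IsAddCyclic (AddCommGroup.torsion H)) :
    ∃ χ : AddChar H ℂ, Function.Injective χ := by
  obtain ⟨r, ι, _, p, hp, e, ⟨φ⟩⟩ := AddCommGroup.equiv_free_prod_directSum_zmod H
  have (i : ι) : NeZero (p i ^ e i) := ⟨pow_ne_zero _ (hp i).ne_zero⟩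
  classical
  let D := DirectSum ι fun i => ZMod (p i ^ e i)
  have : Finite D := Finite.of_equiv _ (DirectSum.addEquivProd fun i => ZMod (p i ^ e i)).symm.toEquiv
  have hD : IsAddCyclic D := by
    let j : D →+ H := φ.symm.toAddMonoidHom.comp (AddMonoidHom.inr _ _)
    have hj : Function.Injective j := φ.symm.injective.comp (Prod.mk_right_injective 0)
    let k : D →+ AddCommGroup.torsion H := j.codRestrict _ fun x =>
      j.isOfFinAddOrder (isOfFinAddOrder_of_finite x)
    exact isAddCyclic_of_injective k fun x y hxy => hj (congrArg Subtype.val hxy)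
  have : NeZero (Nat.card D) := ⟨Nat.card_pos.ne'⟩
  let ε : ZMod (Nat.card D) ≃+ D := zmodAddCyclicAddEquiv hD
  obtain ⟨v, hv⟩ : ∃ v : Fin r → ℝ, LinearIndependent ℚ v :=
    exists_linearIndependent_of_le_rank (by
      rw [Real.rank_rat_real]
      exact (Cardinal.nat_lt_continuum r).le)
  have hv' : LinearIndependent ℤ v := hv.restrict_scalars' ℤ
  let ψ : (Fin r →₀ ℤ) →ₗ[ℤ] ℝ := Finsupp.linearCombination ℤ v
  have hψ : Function.Injective ψ := hv'
  let χ : AddChar ((Fin r →₀ ℤ) × D) ℂ :=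
    { toFun := fun x => (Real.exp (ψ x.1) : ℂ) * ZMod.toCircle (ε.symm x.2)
      map_zero_eq_one' := by simp
      map_add_eq_mul' := by
        intro x y
        simp only [Prod.fst_add, Prod.snd_add, map_add, Real.exp_add, AddChar.map_add_eq_mul,
          Circle.coe_mul, Complex.ofReal_mul]
        ring }
  have hχ : Function.Injective χ := by
    intro x y hxy
    change (Real.exp (ψ x.1) : ℂ) * ZMod.toCircle (ε.symm x.2) =
      (Real.exp (ψ y.1) : ℂ) * ZMod.toCircle (ε.symm y.2) at hxy
    have hnorm : Real.exp (ψ x.1) = Real.exp (ψ y.1) := by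
      have := congrArg norm hxy
      rwa [norm_mul, norm_mul, Circle.norm_coe, Circle.norm_coe, mul_one, mul_one,
        Complex.norm_real, Complex.norm_real, Real.norm_of_nonneg (Real.exp_pos _).le,
        Real.norm_of_nonneg (Real.exp_pos _).le] at this
    rw [hnorm] at hxy
    have hcirc := mul_left_cancel₀ (Complex.ofReal_ne_zero.2 (Real.exp_pos _).ne') hxy
    exact Prod.ext (hψ (Real.exp_injective hnorm))
      (ε.symm.injective (ZMod.injective_toCircle (Circle.ext hcirc)))
  exact ⟨χ.compAddMonoidHom φ.toAddMonoidHom, hχ.comp φ.injective⟩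

/-- If the torsion subgroup of `G` is cyclic, then every finite subset of `G` is contained in a
subgroup which embeds into `ℂˣ`. -/
theorem AddCommGroup.exists_addSubgroup_injective_addChar {G : Type*} [AddCommGroup G]
    (hTor : IsAddCyclic (AddCommGroup.torsion G)) (S : Finset G) :
    ∃ (H : AddSubgroup G) (χ : AddChar H ℂ), (S : Set G) ⊆ H ∧ Function.Injective χ := by
  let H := AddSubgroup.closure (S : Set G)
  have : AddGroup.FG H := (AddGroup.fg_iff_addSubgroup_fg H).2 ⟨S, rfl⟩
  have hH : IsAddCyclic (AddCommGroup.torsion H) := by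
    let k : AddCommGroup.torsion H →+ AddCommGroup.torsion G :=
      (H.subtype.comp (AddCommGroup.torsion H).subtype).codRestrict _ fun x =>
        H.subtype.isOfFinAddOrder x.2
    refine isAddCyclic_of_injective k fun x y hxy => ?_
    have hval : (k x : G) = k y := congrArg Subtype.val hxy
    exact Subtype.ext (Subtype.ext hval)
  obtain ⟨χ, hχ⟩ := AddChar.exists_injective_complex hH
  exact ⟨H, χ, AddSubgroup.subset_closure, hχ⟩


/-- **Theorem 1.2** (Pan–Sun). Let `G` be an abelian group whose torsion subgroup is cyclic,
and let `A`, `B` be finite nonempty subsets of `G`. For `i = 1, …, l` let `m i, n i` be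
nonnegative integers and `d i ∈ G`. If the restricted sumset
`C = {a + b : a ∈ A, b ∈ B, mᵢ·a - nᵢ·b ≠ dᵢ for all i}` is nonempty, then
`|C| ≥ |A| + |B| - ∑ i (mᵢ + nᵢ) - min_{c ∈ C} ν_{A,B}(c)`. -/
theorem stmt1 {G : Type*} [AddCommGroup G] [DecidableEq G]
    (hTor : IsAddCyclic (AddCommGroup.torsion G))
    (A B : Finset G) (hA : A.Nonempty) (hB : B.Nonempty)
    (l : ℕ) (m n : Fin l → ℕ) (d : Fin l → G)
    (C : Finset G)
    (hC : C = ((A ×ˢ B).filter fun p => ∀ i : Fin l, m i • p.1 - n i • p.2 ≠ d i).image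
      fun p => p.1 + p.2)
    (hCne : C.Nonempty) :
    (C.card : ℤ) ≥ (A.card : ℤ) + B.card - (∑ i : Fin l, ((m i : ℤ) + n i)) -
      C.inf' hCne (fun c => (((A ×ˢ B).filter fun p => p.1 + p.2 = c).card : ℤ)) := by
  obtain ⟨c₀, hc₀, hmin⟩ := C.exists_mem_eq_inf' hCne
    (fun c => (((A ×ˢ B).filter fun p => p.1 + p.2 = c).card : ℤ))
  rw [hmin]
  obtain ⟨H, χ, hS, hχ⟩ :=
    AddCommGroup.exists_addSubgroup_injective_addChar hTor (A ∪ B ∪ Finset.univ.image d)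
  have hAH {a} (ha : a ∈ A) : a ∈ H := hS (by simp [ha])
  have hBH {b} (hb : b ∈ B) : b ∈ H := hS (by simp [hb])
  have hdH (i) : d i ∈ H := hS (by simp)
  classical
  let φ : G → ℂ := fun g => if h : g ∈ H then χ ⟨g, h⟩ else 1
  have hφ {g} (h : g ∈ H) : φ g = χ ⟨g, h⟩ := dif_pos h
  have hφinj {g g'} (h : g ∈ H) (h' : g' ∈ H) (heq : φ g = φ g') : g = g' := by
    rw [hφ h, hφ h'] at heq
    exact Subtype.ext_iff.1 (hχ heq)
  have hφadd {g g'} (h : g ∈ H) (h' : g' ∈ H) : φ (g + g') = φ g * φ g' := by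
    rw [hφ h, hφ h', hφ (add_mem h h'), ← AddChar.map_add_eq_mul]
    rfl
  have hφnsmul {g} (h : g ∈ H) (k : ℕ) : φ (k • g) = φ g ^ k := by
    rw [hφ h, hφ (nsmul_mem h k), ← AddChar.map_nsmul_eq_pow]
    rfl
  have hφne {g} (h : g ∈ H) : φ g ≠ 0 := by
    rw [hφ h]
    exact (χ.val_isUnit _).ne_zero
  let P : MvPolynomial (Fin 2) ℂ := ∏ i, (MvPolynomial.X 0 ^ m i * MvPolynomial.X 1 ^ n i -
    MvPolynomial.C (φ (d i)))
  have hPdeg : P.totalDegree ≤ ∑ i, (m i + n i) := by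
    refine (MvPolynomial.totalDegree_finsetProd _ _).trans (Finset.sum_le_sum fun i _ => ?_)
    refine (MvPolynomial.totalDegree_sub_C_le _ _).trans ((MvPolynomial.totalDegree_mul _ _).trans ?_)
    simp
  have hPe {a b} (ha : a ∈ A) (hb : b ∈ B) :
      MvPolynomial.eval ![φ a, φ (-b)] P ≠ 0 ↔ ∀ i, m i • a - n i • b ≠ d i := by
    rw [MvPolynomial.eval_prod, Finset.prod_ne_zero_iff]
    have hφi (i) : φ (m i • a - n i • b) = φ a ^ m i * φ (-b) ^ n i := by
      rw [sub_eq_add_neg, ← smul_neg, hφadd (nsmul_mem (hAH ha) _)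
        (nsmul_mem (neg_mem (hBH hb)) _), hφnsmul (hAH ha), hφnsmul (neg_mem (hBH hb))]
    refine ⟨fun h i hi => h i (Finset.mem_univ i) ?_, fun h i _ hi => h i ?_⟩
    · simp [← hi, hφi]
    · refine hφinj (sub_mem (nsmul_mem (hAH ha) _) (nsmul_mem (hBH hb) _)) (hdH i) ?_
      simpa [hφi, sub_eq_zero] using hi
  have hφmul {a b} (ha : a ∈ A) (hb : b ∈ B) : φ a = φ (a + b) * φ (-b) := by
    rw [← hφadd (add_mem (hAH ha) (hBH hb)) (neg_mem (hBH hb)), add_neg_cancel_right]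
  have hmemC {c} : c ∈ C ↔
      ∃ a ∈ A, ∃ b ∈ B, (∀ i, m i • a - n i • b ≠ d i) ∧ a + b = c := by
    subst hC
    simp only [Finset.mem_image, Finset.mem_filter, Finset.mem_product, Prod.exists]
    tauto
  obtain ⟨a₀, ha₀, b₀, hb₀, hab₀, rfl⟩ := hmemC.1 hc₀
  have key := MvPolynomial.card_add_card_le_of_eval_ne_zero_imp_eq_mul
    (A.image φ) (B.image fun b => φ (-b)) (C.image φ) P
    (by
      simp only [Finset.forall_mem_image, Finset.exists_mem_image]
      intro a ha b hb hab
      exact ⟨a + b, hmemC.2 ⟨a, ha, b, hb, (hPe ha hb).1 hab, rfl⟩, hφmul ha hb⟩)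
    (Finset.mem_image_of_mem _ ha₀) (Finset.mem_image_of_mem _ hb₀) (Finset.mem_image_of_mem _ hc₀)
    (hφne (neg_mem (hBH hb₀))) ((hPe ha₀ hb₀).2 hab₀) (hφmul ha₀ hb₀)
  rw [Finset.card_image_of_injOn fun a ha a' ha' => hφinj (hAH ha) (hAH ha'),
    Finset.card_image_of_injOn fun b hb b' hb' h =>
      neg_injective (hφinj (neg_mem (hBH hb)) (neg_mem (hBH hb')) h)] at key
  have hν : ((A.image φ ×ˢ B.image fun b => φ (-b)).filter
      fun p => p.1 = φ (a₀ + b₀) * p.2).card ≤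
      ((A ×ˢ B).filter fun p => p.1 + p.2 = a₀ + b₀).card := by
    refine (Finset.card_le_card ?_).trans
      (Finset.card_image_le (f := fun p : G × G => (φ p.1, φ (-p.2))))
    rintro ⟨x, y⟩ hxy
    simp only [Finset.mem_filter, Finset.mem_product, Finset.mem_image] at hxy
    obtain ⟨⟨⟨a, ha, rfl⟩, b, hb, rfl⟩, hab⟩ := hxy
    refine Finset.mem_image.2 ⟨(a, b), Finset.mem_filter.2 ⟨Finset.mem_product.2 ⟨ha, hb⟩, ?_⟩, rfl⟩
    rw [hφmul ha hb] at hab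
    exact hφinj (add_mem (hAH ha) (hBH hb)) (add_mem (hAH ha₀) (hBH hb₀))
      (mul_right_cancel₀ (hφne (neg_mem (hBH hb))) hab)
  have hCle := Finset.card_image_le (s := C) (f := φ)
  have hsum : ∑ i, ((m i : ℤ) + n i) = ((∑ i, (m i + n i) : ℕ) : ℤ) := by push_cast; rfl
  rw [hsum]
  omega
end

section
/- Let p be a prime and let G be an elementary abelian p-group, i.e., an abelian group in which p·g = 0 for every g ∈ G. Let A, B, S be finite nonempty subsets of G such that the set C = {a+b : a ∈ A, b ∈ B, and a - b ∉ S} is nonempty. Then |C| ≥ |A| + |B| - |S| - min_{c ∈ C} ν_{A,B}(c). -/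
open MvPolynomial in
/-- A polynomial that vanishes at all points of a finite grid but one has total degree at least
the sum of the side lengths of the grid, each decreased by one. -/
theorem MvPolynomial.sum_card_sub_one_le_totalDegree {σ R : Type*} [Fintype σ] [CommRing R]
    [IsDomain R] (f : MvPolynomial σ R) (S : σ → Finset R) (x : σ → R) (hx : ∀ i, x i ∈ S i)
    (hfx : eval x f ≠ 0) (hf : ∀ y : σ → R, (∀ i, y i ∈ S i) → y ≠ x → eval y f = 0) :
    ∑ i, ((S i).card - 1) ≤ f.totalDegree := by
  classical
  let _ : LinearOrder σ := WellOrderingRel.isWellOrder.linearOrder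
  by_contra! hlt
  let m : MonomialOrder σ := MonomialOrder.lex
  let g : MvPolynomial σ R := ∏ i, ∏ r ∈ (S i).erase (x i), (X i - C r)
  let t : σ →₀ ℕ := ∑ i, Finsupp.single i ((S i).card - 1)
  have ht (i : σ) : t i = (S i).card - 1 := by
    simp [t, -Finsupp.single_tsub, Finsupp.finsetSum_apply, Finsupp.single_apply]
  have htdeg : t.degree = ∑ i, ((S i).card - 1) := by
    simp [t, -Finsupp.single_tsub, map_sum]
  have hinner (i : σ) : m.Monic (∏ r ∈ (S i).erase (x i), (X i - C r)) :=
    MonomialOrder.Monic.prod fun r _ ↦ m.monic_X_sub_C i r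
  have hg : m.Monic g := MonomialOrder.Monic.prod fun i _ ↦ hinner i
  have hgt : m.degree g = t := by
    rw [MonomialOrder.degree_prod fun i _ ↦ (hinner i).ne_zero]
    refine Finset.sum_congr rfl fun i _ ↦ ?_
    rw [MonomialOrder.degree_prod fun r _ ↦ (m.monic_X_sub_C i r).ne_zero,
      Finset.sum_congr rfl fun r _ ↦ m.degree_X_sub_C i r]
    simp [Finset.card_erase_of_mem (hx i)]
  have hgcoeff : coeff t g = 1 := by rw [← hgt]; exact hg
  have hgdeg : g.totalDegree ≤ ∑ i, ((S i).card - 1) := by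
    refine (totalDegree_finsetProd _ _).trans (Finset.sum_le_sum fun i _ ↦ ?_)
    refine (totalDegree_finsetProd _ _).trans ?_
    rw [← Finset.card_erase_of_mem (hx i), Finset.card_eq_sum_ones]
    exact Finset.sum_le_sum fun r _ ↦ (totalDegree_sub_C_le _ _).trans (totalDegree_X i).le
  have hfcoeff : coeff t f = 0 := by
    refine coeff_eq_zero_of_totalDegree_lt (hlt.trans_eq ?_)
    rw [← htdeg, Finsupp.degree_apply]
  have hgy (y : σ → R) (hy : ∀ i, y i ∈ S i) (hyx : y ≠ x) : eval y g = 0 := by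
    obtain ⟨i, hi⟩ := Function.ne_iff.mp hyx
    simp only [g, map_prod]
    refine Finset.prod_eq_zero (Finset.mem_univ i) ?_
    exact Finset.prod_eq_zero (Finset.mem_erase.mpr ⟨hi, hy i⟩) (by simp)
  let h : MvPolynomial σ R := C (eval x g) * f - C (eval x f) * g
  have hcoeff : coeff t h ≠ 0 := by
    simpa [h, hfcoeff, hgcoeff] using hfx
  have hdeg : h.totalDegree = t.degree := by
    refine le_antisymm ((totalDegree_sub _ _).trans (max_le ?_ ?_)) ?_
    · refine (totalDegree_mul _ _).trans ?_
      rw [totalDegree_C, zero_add, htdeg]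
      exact hlt.le
    · refine (totalDegree_mul _ _).trans ?_
      rw [totalDegree_C, zero_add, htdeg]
      exact hgdeg
    · exact le_totalDegree (mem_support_iff.mpr hcoeff)
  obtain ⟨y, hyS, hy⟩ := combinatorial_nullstellensatz_exists_eval_nonzero h t hcoeff hdeg S
    fun i ↦ by rw [ht]; exact Nat.sub_lt (Finset.card_pos.mpr ⟨_, hx i⟩) one_pos
  apply hy
  by_cases hyx : y = x
  · subst hyx
    simp [h, mul_comm]
  · simp [h, hf y hyS hyx, hgy y hyS hyx]

open MvPolynomial in
/-- The restricted sumset bound in an abelian group that embeds into the additive group of a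
domain. -/
theorem Finset.card_add_card_le_of_injective_addMonoidHom {G R : Type*} [AddCommGroup G]
    [DecidableEq G] [CommRing R] [IsDomain R] (φ : G →+ R) (hφ : Function.Injective φ)
    (A B S : Finset G) {a₀ b₀ : G} (ha₀ : a₀ ∈ A) (hb₀ : b₀ ∈ B) (hS : a₀ - b₀ ∉ S) :
    A.card + B.card ≤
      (((A ×ˢ B).filter fun q ↦ q.1 - q.2 ∉ S).image fun q ↦ q.1 + q.2).card + S.card +
        ((A ×ˢ B).filter fun q ↦ q.1 + q.2 = a₀ + b₀).card := by
  classical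
  set D := ((A ×ˢ B).filter fun q ↦ q.1 - q.2 ∉ S).image fun q ↦ q.1 + q.2 with hD
  set N := (A ×ˢ B).filter fun q ↦ q.1 + q.2 = a₀ + b₀ with hN
  have hmemD : a₀ + b₀ ∈ D :=
    mem_image.mpr ⟨(a₀, b₀), mem_filter.mpr ⟨mk_mem_product ha₀ hb₀, hS⟩, rfl⟩
  have hmemN : (a₀, b₀) ∈ N := mem_filter.mpr ⟨mk_mem_product ha₀ hb₀, rfl⟩
  let f : MvPolynomial (Fin 2) R :=
    (∏ s ∈ S, (X 0 - X 1 - C (φ s))) * (∏ d ∈ D.erase (a₀ + b₀), (X 0 + X 1 - C (φ d))) *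
      ∏ q ∈ N.erase (a₀, b₀), (X 0 - C (φ q.1))
  have heval (a b : G) : eval ![φ a, φ b] f =
      (∏ s ∈ S, φ (a - b - s)) * (∏ d ∈ D.erase (a₀ + b₀), φ (a + b - d)) *
        ∏ q ∈ N.erase (a₀, b₀), φ (a - q.1) := by
    simp [f, map_prod]
  have hzero (g : G) : φ g = 0 ↔ g = 0 := map_eq_zero_iff φ hφ
  have hdeg : f.totalDegree ≤ S.card + (D.card - 1) + (N.card - 1) := by
    refine (totalDegree_mul _ _).trans (add_le_add ((totalDegree_mul _ _).trans
      (add_le_add ?_ ?_)) ?_)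
    · rw [card_eq_sum_ones]
      refine (totalDegree_finsetProd _ _).trans (sum_le_sum fun s _ ↦ ?_)
      refine (totalDegree_sub_C_le _ _).trans ((totalDegree_sub _ _).trans ?_)
      simp
    · rw [← card_erase_of_mem hmemD, card_eq_sum_ones]
      refine (totalDegree_finsetProd _ _).trans (sum_le_sum fun s _ ↦ ?_)
      refine (totalDegree_sub_C_le _ _).trans ((totalDegree_add _ _).trans ?_)
      simp
    · rw [← card_erase_of_mem hmemN, card_eq_sum_ones]
      refine (totalDegree_finsetProd _ _).trans (sum_le_sum fun s _ ↦ ?_)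
      exact (totalDegree_sub_C_le _ _).trans (totalDegree_X _).le
  have hmain := sum_card_sub_one_le_totalDegree f ![A.image φ, B.image φ] ![φ a₀, φ b₀]
    (by simpa [Fin.forall_fin_two] using
      ⟨⟨a₀, ha₀, rfl⟩, ⟨b₀, hb₀, rfl⟩⟩) ?_ ?_
  · simp only [Fin.sum_univ_two, Matrix.cons_val_zero, Matrix.cons_val_one,
      card_image_of_injective _ hφ] at hmain
    have := card_pos.mpr ⟨_, ha₀⟩
    have := card_pos.mpr ⟨_, hb₀⟩
    have := card_pos.mpr ⟨_, hmemD⟩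
    have := card_pos.mpr ⟨_, hmemN⟩
    omega
  · rw [heval]
    refine mul_ne_zero (mul_ne_zero ?_ ?_) ?_ <;>
      refine prod_ne_zero_iff.mpr fun q hq ↦ (hzero _).not.mpr (sub_ne_zero.mpr ?_)
    · rintro rfl
      exact hS hq
    · exact (ne_of_mem_erase hq).symm
    · rintro rfl
      obtain ⟨hne, hq⟩ := mem_erase.mp hq
      exact hne (Prod.ext rfl (add_left_cancel (mem_filter.mp hq).2))
  · intro y hy hne
    obtain ⟨a, ha, hay⟩ : ∃ a ∈ A, φ a = y 0 := by simpa using hy 0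
    obtain ⟨b, hb, hby⟩ : ∃ b ∈ B, φ b = y 1 := by simpa using hy 1
    obtain rfl : y = ![φ a, φ b] := by
      ext i
      fin_cases i <;> simp [hay, hby]
    have hne' : (a, b) ≠ (a₀, b₀) := by
      rintro ⟨⟩
      exact hne rfl
    rw [heval]
    by_cases hab : a - b ∈ S
    · rw [prod_eq_zero hab (by simp), zero_mul, zero_mul]
    by_cases hsum : a + b = a₀ + b₀
    · have : (a, b) ∈ N.erase (a₀, b₀) :=
        mem_erase.mpr ⟨hne', mem_filter.mpr ⟨mk_mem_product ha hb, hsum⟩⟩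
      rw [prod_eq_zero this (by simp), mul_zero]
    · have : a + b ∈ D.erase (a₀ + b₀) := mem_erase.mpr
        ⟨hsum, mem_image.mpr ⟨(a, b), mem_filter.mpr ⟨mk_mem_product ha hb, hab⟩, rfl⟩⟩
      rw [prod_eq_zero this (by simp), mul_zero, zero_mul]

/-- A vector space embeds additively into a polynomial ring over the base field. -/
theorem exists_injective_linearMap_mvPolynomial (K V : Type*) [Field K] [AddCommGroup V]
    [Module K V] :
    ∃ φ : V →ₗ[K] MvPolynomial (Module.Basis.ofVectorSpaceIndex K V) K, Function.Injective φ := by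
  refine ⟨Finsupp.linearCombination K MvPolynomial.X ∘ₗ
    (Module.Basis.ofVectorSpace K V).repr.toLinearMap, ?_⟩
  rw [LinearMap.coe_comp]
  have hX : Function.Injective (Finsupp.linearCombination K
      (MvPolynomial.X : Module.Basis.ofVectorSpaceIndex K V → MvPolynomial _ K)) :=
    MvPolynomial.linearIndependent_X _ _
  exact hX.comp (LinearEquiv.injective _)


/-- **Theorem 1.3(i), elementary abelian case** (Pan–Sun). Let `p` be a prime and `G` an
elementary abelian `p`-group (`p • g = 0` for all `g`). Let `A`, `B`, `S` be finite nonempty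
subsets of `G` such that `C = {a + b : a ∈ A, b ∈ B, a - b ∉ S}` is nonempty. Then
`|C| ≥ |A| + |B| - |S| - min_{c ∈ C} ν_{A,B}(c)`. -/
theorem stmt3 {G : Type*} [AddCommGroup G] [DecidableEq G]
    (p : ℕ) (hp : p.Prime) (hpG : ∀ g : G, p • g = 0)
    (A B S : Finset G) (hA : A.Nonempty) (hB : B.Nonempty) (hS : S.Nonempty)
    (C : Finset G)
    (hC : C = ((A ×ˢ B).filter fun q => q.1 - q.2 ∉ S).image fun q => q.1 + q.2)
    (hCne : C.Nonempty) :
    (C.card : ℤ) ≥ (A.card : ℤ) + B.card - S.card -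
      C.inf' hCne (fun c => (((A ×ˢ B).filter fun q => q.1 + q.2 = c).card : ℤ)) := by
  have : Fact p.Prime := ⟨hp⟩
  let _ : Module (ZMod p) G := AddCommGroup.zmodModule hpG
  obtain ⟨φ, hφ⟩ := exists_injective_linearMap_mvPolynomial (ZMod p) G
  obtain ⟨c, hc, hmin⟩ := C.exists_mem_eq_inf' hCne
    fun c ↦ (((A ×ˢ B).filter fun q => q.1 + q.2 = c).card : ℤ)
  rw [hmin]
  subst hC
  obtain ⟨⟨a, b⟩, hab, rfl⟩ := Finset.mem_image.mp hc
  obtain ⟨hmem, hS'⟩ := Finset.mem_filter.mp hab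
  obtain ⟨ha, hb⟩ := Finset.mem_product.mp hmem
  have hbound := Finset.card_add_card_le_of_injective_addMonoidHom φ.toAddMonoidHom hφ A B S ha hb hS'
  dsimp only at hbound ⊢
  omega
end

section
/- Let G be an abelian group whose torsion subgroup Tor(G) = {g ∈ G : g has finite order} is cyclic, and let A, B, S be finite nonempty subsets of G such that the set C = {a+b : a ∈ A, b ∈ B, and a - b ∉ S} is nonempty. Then |C| ≥ |A| + |B| - 2|S| - min_{c ∈ C} ν_{A,B}(c). -/
open Finset in
theorem Finset.sum_pow_div_prod_sub_eq_zero {F : Type*} [Field F] [DecidableEq F]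
    (s : Finset F) {k : ℕ} (hk : k + 1 < #s) :
    ∑ a ∈ s, a ^ k / ∏ b ∈ s.erase a, (a - b) = 0 := by
  have hdeg : (Polynomial.X ^ k : Polynomial F).degree < #s := by
    rw [Polynomial.degree_X_pow]
    exact_mod_cast (by omega : k < #s)
  have h := Lagrange.coeff_eq_sum (v := id) (s := s) Function.injective_id.injOn hdeg
  rw [Polynomial.coeff_X_pow, if_neg (by omega)] at h
  simpa using h.symm

open Finset in
theorem MvPolynomial.sum_piFinset_eval_div_prod_sub_eq_zero {σ F : Type*} [Fintype σ]
    [DecidableEq σ] [Field F] [DecidableEq F] (f : MvPolynomial σ F) (s : σ → Finset F)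
    (hf : f.totalDegree < ∑ i, (#(s i) - 1)) :
    ∑ x ∈ Fintype.piFinset s, eval x f * ∏ i, (∏ b ∈ (s i).erase (x i), (x i - b))⁻¹ = 0 := by
  simp_rw [eval_eq', sum_mul]
  rw [sum_comm]
  refine sum_eq_zero fun d hd => ?_
  simp_rw [mul_assoc, ← prod_mul_distrib, ← div_eq_mul_inv, ← mul_sum]
  rw [← prod_univ_sum s (fun i a => a ^ d i / ∏ b ∈ (s i).erase a, (a - b))]
  have hdeg : ∑ i, d i < ∑ i, (#(s i) - 1) := by
    refine lt_of_le_of_lt ?_ hf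
    simpa [Finsupp.sum_fintype] using le_totalDegree hd
  obtain ⟨i, -, hi⟩ := exists_lt_of_sum_lt hdeg
  rw [prod_eq_zero (mem_univ i) (sum_pow_div_prod_sub_eq_zero (s i) (by omega)), mul_zero]

open Finset in
/-- A polynomial that is nonzero at exactly one point of a grid has large total degree. -/
theorem MvPolynomial.exists_ne_eval_ne_zero_of_totalDegree_lt {σ F : Type*} [Fintype σ]
    [Field F] (f : MvPolynomial σ F) (s : σ → Finset F)
    (hf : f.totalDegree < ∑ i, (#(s i) - 1)) (x : σ → F) (hx : ∀ i, x i ∈ s i)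
    (hfx : eval x f ≠ 0) :
    ∃ y, (∀ i, y i ∈ s i) ∧ y ≠ x ∧ eval y f ≠ 0 := by
  classical
  by_contra! h
  have hsum := sum_piFinset_eval_div_prod_sub_eq_zero f s hf
  rw [sum_eq_single_of_mem x (Fintype.mem_piFinset.2 hx)
    fun y hy hyx => by rw [h y (Fintype.mem_piFinset.1 hy) hyx, zero_mul]] at hsum
  refine mul_ne_zero hfx (prod_ne_zero_iff.2 fun i _ => inv_ne_zero ?_) hsum
  exact prod_ne_zero_iff.2 fun b hb => sub_ne_zero.2 (ne_of_mem_erase hb).symm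

theorem IsAddCyclic.exists_addMonoidHom_unitAddCircle_injOn_torsion {G : Type*} [AddCommGroup G]
    (hTor : IsAddCyclic (AddCommGroup.torsion G)) :
    ∃ χ : G →+ UnitAddCircle, Set.InjOn χ (AddCommGroup.torsion G) := by
  obtain ⟨g, hg⟩ := hTor.exists_generator
  have hpos : 0 < addOrderOf g := by
    rw [addOrderOf_pos_iff, ← AddSubmonoid.isOfFinAddOrder_coe]
    exact g.2
  have : NeZero (Nat.card (AddCommGroup.torsion G)) := by
    rw [← addOrderOf_eq_card_of_forall_mem_zmultiples hg]
    exact ⟨hpos.ne'⟩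
  let e := zmodAddCyclicAddEquiv hTor
  obtain ⟨χ, hχ⟩ := (Module.Baer.of_divisible UnitAddCircle).extension_property_addMonoidHom
    (AddCommGroup.torsion G).subtype Subtype.val_injective
    (ZMod.toAddCircle.comp e.symm.toAddMonoidHom)
  refine ⟨χ, fun x hx y hy hxy => ?_⟩
  have key := fun z : AddCommGroup.torsion G => DFunLike.congr_fun hχ z
  have h := (key ⟨x, hx⟩).symm.trans (Eq.trans hxy (key ⟨y, hy⟩))
  exact congrArg Subtype.val (e.symm.injective (ZMod.toAddCircle_injective _ h))

theorem exists_addMonoidHom_real_ne_zero {G : Type*} [AddCommGroup G] {d : G}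
    (hd : ¬ IsOfFinAddOrder d) : ∃ l : G →+ ℝ, l d ≠ 0 := by
  obtain ⟨l, hl⟩ := (Module.Baer.of_divisible ℝ).extension_property_addMonoidHom
    (zmultiplesHom G d) (injective_zsmul_iff_not_isOfFinAddOrder.2 hd) (Int.castAddHom ℝ)
  refine ⟨l, ?_⟩
  have h := DFunLike.congr_fun hl 1
  simp only [AddMonoidHom.comp_apply, zmultiplesHom_apply, one_zsmul] at h
  simp [h]

theorem exists_addMonoidHom_real_forall_ne_zero {G : Type*} [AddCommGroup G] (D : Finset G) :
    ∃ l : G →+ ℝ, ∀ d ∈ D, ¬ IsOfFinAddOrder d → l d ≠ 0 := by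
  have : Finite {d // d ∈ D ∧ ¬ IsOfFinAddOrder d} :=
    (D.finite_toSet.subset fun _ hd => hd.1).to_subtype
  let ev (d : G) : Module.Dual ℝ (G →+ ℝ) :=
    { toFun := fun l => l d
      map_add' := fun _ _ => rfl
      map_smul' := fun _ _ => rfl }
  obtain ⟨l, hl⟩ := Module.Dual.exists_forall_ne_zero_of_forall_exists
    (fun d : {d // d ∈ D ∧ ¬ IsOfFinAddOrder d} => ev d)
    fun d => exists_addMonoidHom_real_ne_zero d.2.2
  exact ⟨l, fun d hd hd' => hl ⟨d, hd, hd'⟩⟩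

/-- If the torsion subgroup is cyclic, then finitely many nonzero elements are simultaneously
detected by one homomorphism to the multiplicative group of `ℂ`. -/
theorem IsAddCyclic.exists_addChar_forall_ne_one {G : Type*} [AddCommGroup G]
    (hTor : IsAddCyclic (AddCommGroup.torsion G)) (D : Finset G) :
    ∃ ψ : AddChar G ℂ, ∀ d ∈ D, d ≠ 0 → ψ d ≠ 1 := by
  obtain ⟨χ, hχ⟩ := hTor.exists_addMonoidHom_unitAddCircle_injOn_torsion
  obtain ⟨l, hl⟩ := exists_addMonoidHom_real_forall_ne_zero D
  let ψ : AddChar G ℂ :=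
    { toFun := fun g => (AddCircle.toCircle (χ g) : ℂ) * (Real.exp (l g) : ℂ)
      map_zero_eq_one' := by simp
      map_add_eq_mul' := fun a b => by
        simp only [map_add, AddCircle.toCircle_add, Circle.coe_mul, Real.exp_add,
          Complex.ofReal_mul]
        ring }
  refine ⟨ψ, fun d hd hd0 h => hd0 ?_⟩
  replace h : (AddCircle.toCircle (χ d) : ℂ) * (Real.exp (l d) : ℂ) = 1 := h
  have hld : l d = 0 := by
    have := congrArg norm h
    rw [norm_mul, Circle.norm_coe, one_mul, Complex.norm_real, norm_one, Real.norm_eq_abs,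
      Real.abs_exp, Real.exp_eq_one_iff] at this
    exact this
  have htor : IsOfFinAddOrder d := not_not.1 fun hn => hl d hd hn hld
  rw [hld, Real.exp_zero, Complex.ofReal_one, mul_one, Circle.coe_eq_one] at h
  refine hχ htor (zero_mem _) (AddCircle.injective_toCircle one_ne_zero ?_)
  rw [h, map_zero, AddCircle.toCircle_zero]

theorem IsAddCyclic.exists_addChar_injOn {G : Type*} [AddCommGroup G]
    (hTor : IsAddCyclic (AddCommGroup.torsion G)) (X : Finset G) :
    ∃ ψ : AddChar G ℂ, Set.InjOn ψ X := by
  classical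
  obtain ⟨ψ, hψ⟩ := hTor.exists_addChar_forall_ne_one ((X ×ˢ X).image fun p => p.1 - p.2)
  refine ⟨ψ, fun x hx y hy hxy => by_contra fun hne => ?_⟩
  refine hψ (x - y) (Finset.mem_image.2 ⟨(x, y), Finset.mem_product.2 ⟨hx, hy⟩, rfl⟩)
    (sub_ne_zero.2 hne) ?_
  rw [AddChar.map_sub_eq_div, hxy, div_self (ψ.val_isUnit y).ne_zero]

open Finset MvPolynomial in
/-- The bound for a sum with a unique admissible representation. -/
theorem IsAddCyclic.card_add_card_le_of_unique {G : Type*} [AddCommGroup G] [DecidableEq G]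
    (hTor : IsAddCyclic (AddCommGroup.torsion G)) (A B S C : Finset G)
    (hC : ∀ a ∈ A, ∀ b ∈ B, a - b ∉ S → a + b ∈ C) {a₀ b₀ : G} (ha₀ : a₀ ∈ A) (hb₀ : b₀ ∈ B)
    (hS₀ : a₀ - b₀ ∉ S)
    (huniq : ∀ a ∈ A, ∀ b ∈ B, a + b = a₀ + b₀ → a = a₀) :
    #A + #B ≤ #C + 2 * #S + 1 := by
  let Y := insert (a₀ + b₀) (insert (a₀ - b₀) (A ∪ B ∪ S ∪ C))
  obtain ⟨ψ, hψ⟩ := hTor.exists_addChar_injOn Y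
  have hinj : ∀ {x y}, x ∈ Y → y ∈ Y → ψ x = ψ y → x = y := fun hx hy h => hψ hx hy h
  have hAY : ∀ a ∈ A, a ∈ Y := by simp +contextual [Y]
  have hBY : ∀ b ∈ B, b ∈ Y := by simp +contextual [Y]
  have hSY : ∀ s ∈ S, s ∈ Y := by simp +contextual [Y]
  have hCY : ∀ c ∈ C, c ∈ Y := by simp +contextual [Y]
  have hcardA : #(A.image ψ) = #A :=
    card_image_of_injOn fun x hx y hy h => hinj (hAY x hx) (hAY y hy) h
  have hcardB : #(B.image fun b => ψ (-b)) = #B := by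
    refine card_image_of_injOn fun x hx y hy h => hinj (hBY x hx) (hBY y hy) ?_
    simpa [AddChar.map_neg_eq_inv] using h
  have hc₀ : a₀ + b₀ ∈ C := hC _ ha₀ _ hb₀ hS₀
  by_contra! hlt
  let f : MvPolynomial (Fin 2) ℂ :=
    (∏ c ∈ C.erase (a₀ + b₀), (X 0 - MvPolynomial.C (ψ c) * X 1)) *
      ∏ s ∈ S, (X 0 * X 1 - MvPolynomial.C (ψ s))
  have heval (a b : G) : eval ![ψ a, ψ (-b)] f =
      (∏ c ∈ C.erase (a₀ + b₀), (ψ a - ψ (c - b))) * ∏ s ∈ S, (ψ (a - b) - ψ s) := by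
    simp [f, sub_eq_add_neg, AddChar.map_add_eq_mul]
  have hdeg : f.totalDegree ≤ (#C - 1) + 2 * #S := by
    refine (totalDegree_mul _ _).trans (add_le_add ?_ ?_)
    · refine (totalDegree_finsetProd _ _).trans ?_
      rw [← card_erase_of_mem hc₀, ← mul_one #(C.erase _), ← smul_eq_mul]
      refine sum_le_card_nsmul _ _ _ fun c _ => ?_
      refine (totalDegree_sub _ _).trans (max_le (totalDegree_X _).le ?_)
      refine (totalDegree_mul _ _).trans ?_
      rw [totalDegree_C, totalDegree_X, zero_add]
    · refine (totalDegree_finsetProd _ _).trans ?_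
      rw [mul_comm 2, ← smul_eq_mul #S]
      refine sum_le_card_nsmul _ _ _ fun s _ => ?_
      refine (totalDegree_sub _ _).trans (max_le ?_ ?_)
      · refine (totalDegree_mul _ _).trans ?_
        rw [totalDegree_X, totalDegree_X]
      · rw [totalDegree_C]
        exact Nat.zero_le 2
  have hC1 : 0 < #C := card_pos.2 ⟨_, hc₀⟩
  have hA1 : 0 < #A := card_pos.2 ⟨_, ha₀⟩
  have hB1 : 0 < #B := card_pos.2 ⟨_, hb₀⟩
  obtain ⟨y, hy, hne, hfy⟩ := exists_ne_eval_ne_zero_of_totalDegree_lt f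
    ![A.image ψ, B.image fun b => ψ (-b)]
    (by
      simp only [Fin.sum_univ_two, Matrix.cons_val_zero, Matrix.cons_val_one, hcardA, hcardB]
      omega)
    ![ψ a₀, ψ (-b₀)]
    (by
      rw [Fin.forall_fin_two]
      exact ⟨mem_image_of_mem _ ha₀, mem_image_of_mem (fun b => ψ (-b)) hb₀⟩)
    (by
      rw [heval]
      refine mul_ne_zero (prod_ne_zero_iff.2 fun c hc h => ?_) (prod_ne_zero_iff.2 fun s hs h => ?_)
      · refine ne_of_mem_erase hc (hinj (hCY c (mem_of_mem_erase hc)) (by simp [Y]) ?_)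
        rw [AddChar.map_add_eq_mul, sub_eq_zero.1 h, ← AddChar.map_add_eq_mul, sub_add_cancel]
      · rw [hinj (by simp [Y]) (hSY s hs) (sub_eq_zero.1 h)] at hS₀
        exact hS₀ hs)
  rw [Fin.forall_fin_two] at hy
  obtain ⟨a, ha, hya⟩ := mem_image.1 hy.1
  obtain ⟨b, hb, hyb⟩ := mem_image.1 hy.2
  obtain rfl : y = ![ψ a, ψ (-b)] := by
    ext i
    fin_cases i
    · exact hya.symm
    · exact hyb.symm
  rw [heval, mul_ne_zero_iff, prod_ne_zero_iff, prod_ne_zero_iff] at hfy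
  have hab : a - b ∉ S := fun h => hfy.2 _ h (sub_self _)
  have hsum : a + b = a₀ + b₀ := by
    by_contra h
    refine hfy.1 _ (mem_erase.2 ⟨h, hC a ha b hb hab⟩) ?_
    rw [add_sub_cancel_right, sub_self]
  obtain rfl := huniq a ha b hb hsum
  exact hne (by rw [add_left_cancel hsum])


/-- **Theorem 1.3(ii)** (Pan–Sun). Let `G` be an abelian group whose torsion subgroup is
cyclic, and let `A`, `B`, `S` be finite nonempty subsets of `G` such that
`C = {a + b : a ∈ A, b ∈ B, a - b ∉ S}` is nonempty. Then
`|C| ≥ |A| + |B| - 2|S| - min_{c ∈ C} ν_{A,B}(c)`. -/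
theorem stmt4 {G : Type*} [AddCommGroup G] [DecidableEq G]
    (hTor : IsAddCyclic (AddCommGroup.torsion G))
    (A B S : Finset G) (hA : A.Nonempty) (hB : B.Nonempty) (hS : S.Nonempty)
    (C : Finset G)
    (hC : C = ((A ×ˢ B).filter fun p => p.1 - p.2 ∉ S).image fun p => p.1 + p.2)
    (hCne : C.Nonempty) :
    (C.card : ℤ) ≥ (A.card : ℤ) + B.card - 2 * S.card -
      C.inf' hCne (fun c => (((A ×ˢ B).filter fun p => p.1 + p.2 = c).card : ℤ)) := by
  obtain ⟨c₀, hc₀, hmin⟩ := C.exists_mem_eq_inf' hCne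
    (fun c => (((A ×ˢ B).filter fun p => p.1 + p.2 = c).card : ℤ))
  rw [hmin]
  have hmem := hc₀
  rw [hC, Finset.mem_image] at hmem
  obtain ⟨⟨a₀, b₀⟩, h₀, rfl⟩ := hmem
  rw [Finset.mem_filter, Finset.mem_product] at h₀
  obtain ⟨⟨ha₀, hb₀⟩, hS₀⟩ := h₀
  dsimp only at ha₀ hb₀ hS₀ ⊢
  let P : G → Prop := fun a => a₀ + b₀ - a ∈ B → a = a₀
  have hbound := hTor.card_add_card_le_of_unique (A.filter P) B S C
    (fun a ha b hb hab => by
      rw [hC]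
      exact Finset.mem_image.2 ⟨(a, b), Finset.mem_filter.2
        ⟨Finset.mem_product.2 ⟨(Finset.mem_filter.1 ha).1, hb⟩, hab⟩, rfl⟩)
    (Finset.mem_filter.2 ⟨ha₀, fun _ => rfl⟩) hb₀ hS₀
    (fun a ha b hb hab => (Finset.mem_filter.1 ha).2 (by rwa [← hab, add_sub_cancel_left]))
  have hcard := Finset.card_filter_add_card_filter_not (s := A) P
  have hrep : (A.filter fun a => ¬ P a).card + 1 ≤
      ((A ×ˢ B).filter fun p => p.1 + p.2 = a₀ + b₀).card := by
    rw [← Finset.card_erase_add_one (a := (a₀, b₀)) (by simp [ha₀, hb₀])]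
    refine Nat.succ_le_succ (Finset.card_le_card_of_injOn (fun a => (a, a₀ + b₀ - a)) ?_ ?_)
    · intro a ha
      simp only [P, Finset.coe_filter, Set.mem_ofPred_eq, Classical.not_imp] at ha
      simp [ha]
    · exact fun a _ a' _ h => congrArg Prod.fst h
  omega
end

section
/- Let F be a field and let A and B be finite nonempty subsets of F. Then the sumset A + B = {a+b : a ∈ A, b ∈ B} satisfies |A + B| ≥ |A| + |B| - min_{c ∈ A+B} ν_{A,B}(c). -/
open scoped Pointwise

/-- **Kemperman–Scherk inequality** in an abelian group, with the number of representations
of `c` written as the number of `b ∈ B` such that `c - b ∈ A`. -/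
theorem card_add_card_le_card_add_add_card_filter_sub_mem {G : Type*} [AddCommGroup G]
    [DecidableEq G] {c b₀ : G} (A B : Finset G) (ha₀ : c - b₀ ∈ A) (hb₀ : b₀ ∈ B) :
    A.card + B.card ≤ (A + B).card + (B.filter fun b => c - b ∈ A).card := by
  induction B using Finset.strongInduction generalizing A with
  | H B ih =>
    by_cases hstable : ∀ a ∈ A, ∀ b ∈ B, a - b₀ + b ∈ A
    · have hfilter : (B.filter fun b => c - b ∈ A) = B := by
        refine Finset.filter_true_of_mem fun b hb => ?_
        obtain ⟨x, hx, hxc⟩ := Finset.surj_on_of_inj_on_of_card_le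
          (s := A) (t := A) (fun x _ => x - b₀ + b) (fun x hx => hstable x hx b hb)
          (fun x y _ _ h => by simpa using h) le_rfl (c - b₀) ha₀
        have : c - b = x := by
          rw [sub_eq_iff_eq_add, ← sub_eq_zero]
          rw [← sub_eq_zero] at hxc
          rw [← hxc]
          abel
        rwa [this]
      rw [hfilter]
      exact Nat.add_le_add_right (Finset.card_le_card_add_right ⟨b₀, hb₀⟩) _
    · push Not at hstable
      obtain ⟨a, ha, b₁, hb₁, hab⟩ := hstable
      -- Apply the Dyson transform with parameter `e`.
      set e := a - b₀ with he
      set B' := B.filter fun b => e + b ∈ A with hB'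
      set D := B.filter fun b => e + b ∉ A with hD
      set A' := A ∪ D.image (e + ·) with hA'
      have hBD : B'.card + D.card = B.card := Finset.card_filter_add_card_filter_not _
      have hcardA : A'.card = A.card + D.card := by
        rw [hA', Finset.card_union_of_disjoint, Finset.card_image_of_injective _
          (add_right_injective e)]
        rw [Finset.disjoint_right]
        simp only [hD, Finset.mem_image, Finset.mem_filter]
        rintro _ ⟨b, hb, rfl⟩
        exact hb.2
      have hlt : B' ⊂ B := Finset.filter_ssubset.2 ⟨b₁, hb₁, hab⟩
      have hb₀' : b₀ ∈ B' := by simp [hB', he, hb₀, ha]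
      have hsum : A' + B' ⊆ A + B := by
        intro z hz
        obtain ⟨x, hx, y, hy, rfl⟩ := Finset.mem_add.1 hz
        obtain ⟨hyB, hyA⟩ := Finset.mem_filter.1 hy
        rcases Finset.mem_union.1 hx with hx | hx
        · exact Finset.add_mem_add hx hyB
        · obtain ⟨b, hb, rfl⟩ := Finset.mem_image.1 hx
          have : e + b + y = e + y + b := by abel
          rw [this]
          exact Finset.add_mem_add hyA (Finset.mem_filter.1 hb).1
      have hrep : (B'.filter fun b => c - b ∈ A').card ≤
          (B.filter fun b => c - b ∈ A).card := by
        refine Finset.card_le_card_of_injOn (fun y => if c - y ∈ A then y else c - y - e) ?_ ?_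
        · intro y hy
          simp only [hB', hA', hD, Finset.coe_filter, Finset.mem_filter, Finset.mem_union,
            Finset.mem_image, Set.mem_ofPred_eq] at hy ⊢
          split_ifs with h
          · exact ⟨hy.1.1, h⟩
          · obtain ⟨b, hb, hbe⟩ := hy.2.resolve_left h
            have h₁ : c - y - e = b := by rw [← hbe]; abel
            have h₂ : c - (c - y - e) = e + y := by abel
            exact ⟨h₁ ▸ hb.1, h₂ ▸ hy.1.2⟩
        · intro y hy z hz hyz
          simp only [hB', Finset.coe_filter, Finset.mem_filter, Set.mem_ofPred_eq] at hy hz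
          dsimp only at hyz
          split_ifs at hyz with h₁ h₂ h₂
          · exact hyz
          · exact absurd (by simpa [hyz] using hy.1.2) h₂
          · exact absurd (by simpa [← hyz] using hz.1.2) h₁
          · simpa using hyz
      have := ih B' hlt A' (Finset.mem_union_left _ ha₀) hb₀'
      have := Finset.card_le_card hsum
      omega

/-- Kemperman–Scherk-type bound in a field (Remark 1.1). Let `A`, `B` be finite nonempty
subsets of a field `F`. Then `|A + B| ≥ |A| + |B| - min_{c ∈ A + B} ν_{A,B}(c)`, where
`ν_{A,B}(c)` is the number of pairs `(a,b) ∈ A × B` with `a + b = c`. -/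
theorem stmt8 {F : Type*} [Field F] [DecidableEq F]
    (A B : Finset F) (hA : A.Nonempty) (hB : B.Nonempty) :
    ((A + B).card : ℤ) ≥ (A.card : ℤ) + B.card -
      (A + B).inf' (hA.add hB)
        (fun c => (((A ×ˢ B).filter fun p => p.1 + p.2 = c).card : ℤ)) := by
  rw [ge_iff_le, sub_le_iff_le_add, ← sub_le_iff_le_add']
  refine Finset.le_inf' _ _ fun c hc => ?_
  obtain ⟨a, ha, b, hb, rfl⟩ := Finset.mem_add.1 hc
  have key := card_add_card_le_card_add_add_card_filter_sub_mem (c := a + b) (b₀ := b) A B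
    (by simpa using ha) hb
  have hle : (B.filter fun y => a + b - y ∈ A).card ≤
      ((A ×ˢ B).filter fun p => p.1 + p.2 = a + b).card := by
    refine Finset.card_le_card_of_injOn (fun y => (a + b - y, y)) ?_ ?_
    · intro y hy
      simp only [Finset.coe_filter, Set.mem_ofPred_eq, Finset.mem_product] at hy ⊢
      exact ⟨⟨hy.2, hy.1⟩, sub_add_cancel _ _⟩
    · intro y _ z _ h
      exact congrArg Prod.snd h
  omega
end
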